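/- Let n, d ≥ 1 be integers, let ε ∈ (0,1), and let f : ℝ^d → ℝ be n times continuously differentiable on a neighborhood of [0,1]^d with |∂^α f(x)| ≤ 1 for every multi-index α with |α| ≤ n and every x ∈ [0,1]^d. If N = ⌈(2^{d+1} d^n / (n! ε))^{1/n}⌉, then sup_{x ∈ [0,1]^d} |f(x) − f₁(x)| ≤ ε/2. -/

import Mathlib

open scoped BigOperators

noncomputable section

/-- The piecewise-linear bump function `ψ`. -/
def psi (x : ℝ) : ℝ :=
  if |x| ≤ 1 then 1 else if |x| ≤ 2 then 2 - |x| else 0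

/-- The partition-of-unity factor `φ_m(x) = ∏_{k=1}^d ψ(3N(x_k − m_k/N))`. -/
def phi (d N : ℕ) (m : Fin d → ℕ) (x : Fin d → ℝ) : ℝ :=
  ∏ k, psi (3 * (N : ℝ) * (x k - (m k : ℝ) / (N : ℝ)))

/-- The partial derivative in the `i`-th coordinate direction. -/
def partialDeriv {d : ℕ} (i : Fin d) (f : (Fin d → ℝ) → ℝ) : (Fin d → ℝ) → ℝ :=
  fun x => fderiv ℝ f x (Pi.single i 1)

/-- The multi-index partial derivative `∂^α f`. -/
def multiDeriv {d : ℕ} (α : Fin d → ℕ) (f : (Fin d → ℝ) → ℝ) : (Fin d → ℝ) → ℝ :=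
  (List.finRange d).foldr (fun i g => (partialDeriv i)^[α i] g) f

/-- `P_m`, the Taylor polynomial of `f` of degree `n−1` at the point `m/N`:
`P_m(x) = ∑_{|α| ≤ n−1} (∂^α f(m/N)/α!) (x − m/N)^α`. -/
def taylorP (d n N : ℕ) (f : (Fin d → ℝ) → ℝ) (m : Fin d → ℕ) (x : Fin d → ℝ) : ℝ :=
  ∑ α ∈ Finset.univ.filter (fun α : Fin d → Fin n => (∑ i, (α i : ℕ)) ≤ n - 1),
    (multiDeriv (fun i => (α i : ℕ)) f (fun i => (m i : ℝ) / (N : ℝ))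
        / ∏ i, ((α i : ℕ).factorial : ℝ))
      * ∏ i, (x i - (m i : ℝ) / (N : ℝ)) ^ (α i : ℕ)

/-- The localized Taylor approximant `f₁ = ∑_{m ∈ {0,…,N}^d} φ_m · P_m`. -/
def f1 (d n N : ℕ) (f : (Fin d → ℝ) → ℝ) (x : Fin d → ℝ) : ℝ :=
  ∑ m : Fin d → Fin (N + 1),
    phi d N (fun k => (m k : ℕ)) x * taylorP d n N f (fun k => (m k : ℕ)) x

def pD {d : ℕ} (L : List (Fin d)) (f : (Fin d → ℝ) → ℝ) : (Fin d → ℝ) → ℝ :=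
  L.foldr partialDeriv f

def idxL {d : ℕ} (α : Fin d → ℕ) : List (Fin d) :=
  (List.finRange d).flatMap fun i => List.replicate (α i) i

theorem multiDeriv_eq_pD {d : ℕ} (α : Fin d → ℕ) (f : (Fin d → ℝ) → ℝ) :
    multiDeriv α f = pD (idxL α) f := by
  unfold multiDeriv idxL pD
  induction List.finRange d with
  | nil => rfl
  | cons a l ih =>
    simp only [List.foldr_cons, List.flatMap_cons, List.foldr_append, ih]
    generalize List.foldr partialDeriv f (List.flatMap (fun i => List.replicate (α i) i) l) = g
    induction α a with
    | zero => rfl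
    | succ k ih => rw [Function.iterate_succ_apply', List.replicate_succ, List.foldr_cons, ih]

theorem count_idxL {d : ℕ} (α : Fin d → ℕ) (j : Fin d) : (idxL α).count j = α j := by
  unfold idxL
  rw [List.count_flatMap, ← Fin.sum_univ_def]
  simp [List.count_replicate]

theorem length_idxL {d : ℕ} (α : Fin d → ℕ) : (idxL α).length = ∑ i, α i := by
  unfold idxL
  rw [List.length_flatMap, ← Fin.sum_univ_def]
  simp

theorem contDiffOn_partialDeriv {d : ℕ} {U : Set (Fin d → ℝ)} (hU : IsOpen U) (k : ℕ)
    (i : Fin d) {g : (Fin d → ℝ) → ℝ} (hg : ContDiffOn ℝ ((k + 1 : ℕ) : WithTop ℕ∞) g U) :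
    ContDiffOn ℝ (k : WithTop ℕ∞) (partialDeriv i g) U := by
  unfold partialDeriv
  exact (hg.fderiv_of_isOpen hU (by norm_cast)).clm_apply contDiffOn_const

theorem contDiffOn_pD {d : ℕ} {U : Set (Fin d → ℝ)} (hU : IsOpen U)
    (L : List (Fin d)) {g : (Fin d → ℝ) → ℝ} : ∀ (k : ℕ),
    ContDiffOn ℝ ((k + L.length : ℕ) : WithTop ℕ∞) g U →
    ContDiffOn ℝ (k : WithTop ℕ∞) (pD L g) U := by
  induction L with
  | nil => intro k hg; simpa [pD] using hg
  | cons a l ih =>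
    intro k hg
    refine contDiffOn_partialDeriv hU k a (ih (k + 1) ?_)
    convert hg using 2
    simp; ring

theorem pD_perm {d : ℕ} {U : Set (Fin d → ℝ)} (hU : IsOpen U)
    {L L' : List (Fin d)} (h : L.Perm L') {g : (Fin d → ℝ) → ℝ} :
    ContDiffOn ℝ ((L.length : ℕ) : WithTop ℕ∞) g U → Set.EqOn (pD L g) (pD L' g) U := by
  induction h with
  | nil => intro _ x _; rfl
  | cons a h ih =>
    intro hg x hx
    have := ih (hg.of_le (by simp))
    have he := (this.eventuallyEq_of_mem (hU.mem_nhds hx)).fderiv_eq (𝕜 := ℝ)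
    exact congrArg (fun T : (Fin d → ℝ) →L[ℝ] ℝ => T (Pi.single a 1)) he
  | swap a b l =>
    intro hg x hx
    have h2 : ContDiffOn ℝ ((2 : ℕ) : WithTop ℕ∞) (pD l g) U := by
      apply contDiffOn_pD hU
      convert hg using 2
      simp; ring
    have h2x : ContDiffAt ℝ ((2 : ℕ) : WithTop ℕ∞) (pD l g) x := h2.contDiffAt (hU.mem_nhds hx)
    have hs : IsSymmSndFDerivAt ℝ (pD l g) x :=
      h2x.isSymmSndFDerivAt (by simp [minSmoothness_of_isRCLikeNormedField])
    have hd : DifferentiableAt ℝ (fderiv ℝ (pD l g)) x :=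
      (h2x.fderiv_right (m := 1) (by norm_num)).differentiableAt (by norm_num)
    have key : ∀ u v : Fin d → ℝ, fderiv ℝ (fun y => fderiv ℝ (pD l g) y u) x v =
        fderiv ℝ (fderiv ℝ (pD l g)) x v u := by
      intro u v
      rw [fderiv_clm_apply hd (differentiableAt_const _)]
      simp
    change fderiv ℝ (fun y => fderiv ℝ (pD l g) y _) x _ =
      fderiv ℝ (fun y => fderiv ℝ (pD l g) y _) x _
    rw [key, key]
    exact hs _ _
  | trans h1 h2 ih1 ih2 =>
    intro hg
    exact (ih1 hg).trans (ih2 (by rwa [← h1.length_eq]))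

theorem contDiffOn_multiDeriv {d n : ℕ} {U : Set (Fin d → ℝ)} (hU : IsOpen U)
    {f : (Fin d → ℝ) → ℝ} (hf : ContDiffOn ℝ n f U) (α : Fin d → ℕ) (k : ℕ)
    (h : k + ∑ i, α i ≤ n) : ContDiffOn ℝ k (multiDeriv α f) U := by
  rw [multiDeriv_eq_pD]
  apply contDiffOn_pD hU
  rw [length_idxL]
  exact hf.of_le (by exact_mod_cast h)

theorem partialDeriv_multiDeriv {d n : ℕ} {U : Set (Fin d → ℝ)} (hU : IsOpen U)
    {f : (Fin d → ℝ) → ℝ} (hf : ContDiffOn ℝ n f U) (α : Fin d → ℕ) (i : Fin d)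
    (h : ∑ i, α i + 1 ≤ n) {x : Fin d → ℝ} (hx : x ∈ U) :
    fderiv ℝ (multiDeriv α f) x (Pi.single i 1) = multiDeriv (α + Pi.single i 1) f x := by
  rw [multiDeriv_eq_pD, multiDeriv_eq_pD]
  have hp : (i :: idxL α).Perm (idxL (α + Pi.single i 1)) := by
    rw [List.perm_iff_count]
    intro j
    rw [List.count_cons, count_idxL, count_idxL]
    by_cases hij : i = j
    · subst hij; simp
    · simp [hij, Ne.symm hij]
  refine pD_perm hU hp ?_ hx
  rw [List.length_cons, length_idxL]
  exact hf.of_le (by exact_mod_cast h)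

def GG {d : ℕ} (f : (Fin d → ℝ) → ℝ) (a h : Fin d → ℝ) (k : ℕ) (t : ℝ) : ℝ :=
  ∑ α ∈ Finset.piAntidiag (Finset.univ : Finset (Fin d)) k,
    (multiDeriv α f (a + t • h) / ∏ i, ((α i).factorial : ℝ)) * ∏ i, h i ^ α i

theorem GG_reindex {d : ℕ} (D : (Fin d → ℕ) → ℝ) (h : Fin d → ℝ) (k : ℕ) :
    ∑ α ∈ Finset.piAntidiag (Finset.univ : Finset (Fin d)) k,
      ((∑ i, h i * D (α + Pi.single i 1)) / ∏ i, ((α i).factorial : ℝ)) * ∏ i, h i ^ α i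
    = (k + 1) * ∑ α ∈ Finset.piAntidiag (Finset.univ : Finset (Fin d)) (k + 1),
      (D α / ∏ i, ((α i).factorial : ℝ)) * ∏ i, h i ^ α i := by
  have hR : (k + 1) * ∑ α ∈ Finset.piAntidiag (Finset.univ : Finset (Fin d)) (k + 1),
      (D α / ∏ i, ((α i).factorial : ℝ)) * ∏ i, h i ^ α i =
      ∑ α ∈ Finset.piAntidiag (Finset.univ : Finset (Fin d)) (k + 1), ∑ j,
      (α j : ℝ) * ((D α / ∏ i, ((α i).factorial : ℝ)) * ∏ i, h i ^ α i) := by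
    rw [Finset.mul_sum]
    refine Finset.sum_congr rfl fun α hα => ?_
    rw [← Finset.sum_mul]
    have := (Finset.mem_piAntidiag.1 hα).1
    congr 1
    exact_mod_cast this.symm
  rw [hR]
  simp only [Finset.sum_div, Finset.sum_mul]
  rw [Finset.sum_comm]
  conv_rhs => rw [Finset.sum_comm]
  refine Finset.sum_congr rfl fun j _ => ?_
  have hupd : ∀ α : Fin d → ℕ, (∏ i, (((α + Pi.single j 1 : Fin d → ℕ) i).factorial : ℝ)) =
      (α j + 1) * ∏ i, ((α i).factorial : ℝ) := by
    intro α
    rw [← Finset.mul_prod_erase _ _ (Finset.mem_univ j),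
      ← Finset.mul_prod_erase _ (fun i => ((α i).factorial : ℝ)) (Finset.mem_univ j), ← mul_assoc]
    congr 1
    · simp [Nat.factorial_succ]
    · refine Finset.prod_congr rfl fun i hi => ?_
      simp [(Finset.mem_erase.1 hi).1]
  have hupd2 : ∀ α : Fin d → ℕ, (∏ i, h i ^ ((α + Pi.single j 1 : Fin d → ℕ) i)) =
      h j * ∏ i, h i ^ α i := by
    intro α
    simp only [Pi.add_apply, pow_add, Finset.prod_mul_distrib]
    rw [mul_comm]
    congr 1
    rw [Finset.prod_eq_single j] <;> simp +contextual
  refine Finset.sum_bij_ne_zero (fun α _ _ => α + Pi.single j 1) ?_ ?_ ?_ ?_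
  · intro α hα _
    rw [Finset.mem_piAntidiag] at hα ⊢
    simp [Finset.sum_add_distrib, hα.1]
  · intro α _ _ β _ _ hab
    exact add_right_cancel hab
  · intro β hβ hne
    have hj : β j ≠ 0 := by
      intro h0; apply hne; simp [h0]
    have hb : (β - Pi.single j 1 : Fin d → ℕ) + Pi.single j 1 = β := by
      ext i
      by_cases hij : i = j
      · subst hij; simp; omega
      · simp [hij]
    have hs : ∑ i, (β - Pi.single j 1 : Fin d → ℕ) i = k := by
      have h1 := (Finset.mem_piAntidiag.1 hβ).1
      rw [← hb] at h1
      simp only [Pi.add_apply, Finset.sum_add_distrib, Finset.sum_pi_single', Finset.mem_univ,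
        if_true] at h1
      simpa using h1
    refine ⟨β - Pi.single j 1, ?_, ?_, hb⟩
    · rw [Finset.mem_piAntidiag]; exact ⟨hs, by simp⟩
    · intro h0
      apply hne
      have e1 := hupd (β - Pi.single j 1)
      have e2 := hupd2 (β - Pi.single j 1)
      rw [hb] at e1 e2 h0
      rw [e1, e2]
      rw [div_mul_eq_mul_div, div_eq_zero_iff] at h0
      rcases h0 with h0 | h0
      · have : D β * (h j * ∏ i, h i ^ (β - Pi.single j 1 : Fin d → ℕ) i) = 0 := by
          rw [← h0]; ring
        rw [div_mul_eq_mul_div, this]; simp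
      · rw [h0]; simp
  · intro α hα _
    rw [hupd, hupd2]
    have : (∏ i, ((α i).factorial : ℝ)) ≠ 0 := by positivity
    have : ((α j : ℝ) + 1) ≠ 0 := by positivity
    simp
    field_simp

theorem GG_hasDerivAt {d n : ℕ} {U : Set (Fin d → ℝ)} (hU : IsOpen U)
    {f : (Fin d → ℝ) → ℝ} (hf : ContDiffOn ℝ n f U) (a h : Fin d → ℝ) (k : ℕ) (hk : k < n)
    (t : ℝ) (ht : a + t • h ∈ U) :
    HasDerivAt (GG f a h k) ((k + 1) * GG f a h (k + 1) t) t := by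
  unfold GG
  rw [← GG_reindex (fun α => multiDeriv α f (a + t • h))]
  apply HasDerivAt.fun_sum
  intro α hα
  have hs : ∑ i, α i = k := (Finset.mem_piAntidiag.1 hα).1
  refine (HasDerivAt.div_const ?_ _).mul_const _
  have hc := contDiffOn_multiDeriv hU hf α 1 (by omega)
  have hd : DifferentiableAt ℝ (multiDeriv α f) (a + t • h) :=
    (hc.contDiffAt (hU.mem_nhds ht)).differentiableAt (by simp)
  have hl : HasDerivAt (fun t : ℝ => a + t • h) h t := by
    simpa using ((hasDerivAt_id t).smul_const h).const_add a
  have := hd.hasFDerivAt.comp_hasDerivAt t hl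
  refine this.congr_deriv ?_
  have hT : ∀ T : (Fin d → ℝ) →L[ℝ] ℝ, T h = ∑ i, h i * T (Pi.single i 1) := by
    intro T
    conv_lhs => rw [pi_eq_sum_univ' h]
    rw [map_sum]
    refine Finset.sum_congr rfl fun i _ => ?_
    rw [map_smul, smul_eq_mul]
  rw [hT]
  refine Finset.sum_congr rfl fun i _ => ?_
  rw [partialDeriv_multiDeriv hU hf α i (by omega) ht]

theorem GG_bound {d n : ℕ} {f : (Fin d → ℝ) → ℝ}
    (hbound : ∀ α : Fin d → ℕ, (∑ i, α i) ≤ n →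
      ∀ x ∈ Set.Icc (0 : Fin d → ℝ) 1, |multiDeriv α f x| ≤ 1) (a h : Fin d → ℝ)
    (t : ℝ) (ht : a + t • h ∈ Set.Icc (0 : Fin d → ℝ) 1) :
    |GG f a h n t| ≤ (∑ i, |h i|) ^ n / n.factorial := by
  rw [Finset.sum_pow_eq_sum_piAntidiag, Finset.sum_div]
  refine (Finset.abs_sum_le_sum_abs _ _).trans (Finset.sum_le_sum fun α hα => ?_)
  have hs := (Finset.mem_piAntidiag.1 hα).1
  have hm := Nat.multinomial_spec Finset.univ α
  have hm' : (∏ i, ((α i).factorial : ℝ)) * (Nat.multinomial Finset.univ α : ℝ) = n.factorial := by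
    rw [hs] at hm; exact_mod_cast hm
  have hp : (0:ℝ) < ∏ i, ((α i).factorial : ℝ) := by positivity
  have hp2 : (0:ℝ) < n.factorial := by positivity
  rw [abs_mul, abs_div, abs_of_pos hp, Finset.abs_prod]
  simp only [abs_pow]
  have h0 : 0 ≤ ∏ i, |h i| ^ α i := by positivity
  have h1 := hbound α hs.le _ ht
  calc _ ≤ 1 / (∏ i, ((α i).factorial : ℝ)) * ∏ i, |h i| ^ α i := by gcongr
    _ = _ := by
      rw [← hm']
      have : (Nat.multinomial Finset.univ α : ℝ) ≠ 0 := by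
        intro h; rw [h] at hm'; simp at hm'; exact hp2.ne hm'
      field_simp

theorem taylor_bound {d n : ℕ} (hn : 1 ≤ n) {U : Set (Fin d → ℝ)} (hU : IsOpen U)
    (hUsub : Set.Icc (0 : Fin d → ℝ) 1 ⊆ U)
    {f : (Fin d → ℝ) → ℝ} (hf : ContDiffOn ℝ n f U)
    (hbound : ∀ α : Fin d → ℕ, (∑ i, α i) ≤ n →
      ∀ x ∈ Set.Icc (0 : Fin d → ℝ) 1, |multiDeriv α f x| ≤ 1) (a h : Fin d → ℝ)
    (ha : a ∈ Set.Icc (0 : Fin d → ℝ) 1) (hx : a + h ∈ Set.Icc (0 : Fin d → ℝ) 1) :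
    |f (a + h) - ∑ k ∈ Finset.range n, GG f a h k 0| ≤ (∑ i, |h i|) ^ n / n.factorial := by
  set C := (∑ i, |h i|) ^ n / n.factorial with hC
  have hseg : ∀ t ∈ Set.Icc (0:ℝ) 1, a + t • h ∈ Set.Icc (0 : Fin d → ℝ) 1 := by
    intro t ht
    have := (convex_Icc (0 : Fin d → ℝ) 1) ha hx (sub_nonneg.2 ht.2) ht.1 (by ring)
    convert this using 1
    ext i; simp; ring
  let H : ℝ → ℝ := fun t => ∑ k ∈ Finset.range n, (1 - t) ^ k * GG f a h k t
  have hH : ∀ t ∈ Set.Icc (0:ℝ) 1, HasDerivAt H (n * (1 - t) ^ (n - 1) * GG f a h n t) t := by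
    intro t ht
    have key : ∀ k ∈ Finset.range n, HasDerivAt (fun t => (1 - t) ^ k * GG f a h k t)
        (((k + 1 : ℕ) : ℝ) * (1 - t) ^ (k + 1 - 1) * GG f a h (k + 1) t
          - (k : ℝ) * (1 - t) ^ (k - 1) * GG f a h k t) t := by
      intro k hk
      have h1 := GG_hasDerivAt hU hf a h k (Finset.mem_range.1 hk) t (hUsub (hseg t ht))
      have h2 : HasDerivAt (fun t : ℝ => (1 - t) ^ k) (k * (1 - t) ^ (k - 1) * (-1)) t :=
        ((hasDerivAt_id t).const_sub 1).fun_pow k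
      refine (h2.mul h1).congr_deriv ?_
      simp only [Nat.add_sub_cancel]
      push_cast; ring
    have := HasDerivAt.fun_sum key
    rw [Finset.sum_range_sub (fun k => (k : ℝ) * (1 - t) ^ (k - 1) * GG f a h k t)] at this
    simpa using this
  have hmain := image_norm_le_of_norm_deriv_right_le_deriv_boundary (a := 0) (b := 1)
    (f := fun t => H t - H 0) (f' := fun t => n * (1 - t) ^ (n - 1) * GG f a h n t)
    (B := fun t => C - C * (1 - t) ^ n) (B' := fun t => C * (n * (1 - t) ^ (n - 1)))
    (fun t ht => ((hH t ht).sub_const _).continuousAt.continuousWithinAt)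
    (fun t ht => ((hH t ⟨ht.1, ht.2.le⟩).sub_const _).hasDerivWithinAt)
    (by simp)
    (by
      intro t
      have h2 : HasDerivAt (fun t : ℝ => (1 - t) ^ n) (n * (1 - t) ^ (n - 1) * (-1)) t :=
        ((hasDerivAt_id t).const_sub 1).fun_pow n
      refine ((h2.const_mul C).const_sub C).congr_deriv ?_
      ring)
    (by
      intro t ht
      have hb := GG_bound hbound a h t (hseg t ⟨ht.1, ht.2.le⟩)
      have h0 : 0 ≤ (n:ℝ) * (1 - t) ^ (n - 1) := by
        have : 0 ≤ 1 - t := by linarith [ht.2]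
        positivity
      rw [norm_mul, Real.norm_of_nonneg h0, Real.norm_eq_abs, mul_comm C]
      exact mul_le_mul_of_nonneg_left hb h0)
    (x := 1) (by simp)
  have hH1 : H 1 = f (a + h) := by
    simp only [H]
    rw [Finset.sum_eq_single 0]
    · simp [GG, multiDeriv]
    · intro k _ hk; simp [hk]
    · intro h; simp at h; omega
  have hH0 : H 0 = ∑ k ∈ Finset.range n, GG f a h k 0 := by simp [H]
  rw [← hH1, ← hH0]
  have : n ≠ 0 := by omega
  simpa [this] using hmain

theorem taylorP_eq {d n N : ℕ} (hn : 1 ≤ n) (f : (Fin d → ℝ) → ℝ) (m : Fin d → ℕ)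
    (x : Fin d → ℝ) :
    taylorP d n N f m x = ∑ k ∈ Finset.range n,
      GG f (fun i => (m i : ℝ) / N) (fun i => x i - (m i : ℝ) / N) k 0 := by
  unfold taylorP GG
  rw [Finset.sum_sigma']
  refine Finset.sum_bij (fun α _ => ⟨∑ i, (α i : ℕ), fun i => (α i : ℕ)⟩) ?_ ?_ ?_ ?_
  · intro α hα
    simp at hα ⊢
    omega
  · intro α _ β _ h
    simp only [Sigma.mk.injEq, heq_eq_eq] at h
    ext i
    exact congrFun h.2 i
  · rintro ⟨k, β⟩ hb
    simp at hb
    replace hb : k < n ∧ ∑ i, β i = k := hb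
    have hle : ∀ i, β i < n := fun i =>
      lt_of_le_of_lt (Finset.single_le_sum (f := β) (fun _ _ => Nat.zero_le _) (Finset.mem_univ i))
        (by omega)
    refine ⟨fun i => ⟨β i, hle i⟩, ?_, ?_⟩
    · simp; omega
    · simp [hb.2]
  · intro α _
    simp

theorem psi_nonneg (x : ℝ) : 0 ≤ psi x := by
  unfold psi; split_ifs <;> linarith

theorem psi_eq_zero {x : ℝ} (h : 2 ≤ |x|) : psi x = 0 := by
  unfold psi; split_ifs <;> linarith

theorem psi_pair {t : ℝ} (h0 : 0 ≤ t) (h1 : t ≤ 1) : psi (3 * t) + psi (3 * (t - 1)) = 1 := by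
  unfold psi
  rw [abs_of_nonneg (by linarith), abs_of_nonpos (by linarith)]
  split_ifs <;> linarith

theorem psi_sum (N : ℕ) (hN : 1 ≤ N) (x : ℝ) (h0 : 0 ≤ x) (h1 : x ≤ 1) :
    ∑ m : Fin (N + 1), psi (3 * (N : ℝ) * (x - ((m : ℕ) : ℝ) / N)) = 1 := by
  have hNp : (0:ℝ) < N := by exact_mod_cast hN
  have hr : ∀ m : ℕ, 3 * (N : ℝ) * (x - (m : ℝ) / N) = 3 * (N * x - m) := by
    intro m; field_simp
  simp only [hr]
  rw [Fin.sum_univ_eq_sum_range (fun m => psi (3 * (N * x - (m : ℝ))))]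
  obtain ⟨j, hj, hj0, hj1⟩ : ∃ j : ℕ, j + 1 ≤ N ∧ (j : ℝ) ≤ N * x ∧ N * x ≤ j + 1 := by
    by_cases hx : x = 1
    · refine ⟨N - 1, by omega, ?_, ?_⟩ <;> rw [Nat.cast_sub hN] <;> subst hx <;> simp
    · refine ⟨⌊N * x⌋₊, ?_, Nat.floor_le (by positivity), (Nat.lt_floor_add_one _).le⟩
      have : x < 1 := lt_of_le_of_ne h1 hx
      have : ⌊N * x⌋₊ < N := by
        rw [Nat.floor_lt (by positivity)]; nlinarith
      omega
  have hsub : ({j, j + 1} : Finset ℕ) ⊆ Finset.range (N + 1) := by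
    intro i hi; simp at hi ⊢; omega
  rw [← Finset.sum_subset hsub]
  · rw [Finset.sum_pair (by omega)]
    have := psi_pair (t := N * x - j) (by linarith) (by linarith)
    rw [← this]; push_cast; ring_nf
  · intro i _ hi
    simp at hi
    apply psi_eq_zero
    rcases lt_or_ge i j with h | h
    · have : (i : ℝ) + 1 ≤ j := by exact_mod_cast h
      rw [le_abs]; left; linarith
    · have : (j : ℝ) + 2 ≤ i := by
        have : j + 2 ≤ i := by omega
        exact_mod_cast this
      rw [le_abs]; right; linarith

theorem phi_nonneg (d N : ℕ) (m : Fin d → ℕ) (x : Fin d → ℝ) : 0 ≤ phi d N m x :=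
  Finset.prod_nonneg fun _ _ => psi_nonneg _

theorem phi_sum (d N : ℕ) (hN : 1 ≤ N) (x : Fin d → ℝ) (hx : x ∈ Set.Icc (0 : Fin d → ℝ) 1) :
    ∑ m : Fin d → Fin (N + 1), phi d N (fun k => (m k : ℕ)) x = 1 := by
  unfold phi
  rw [← Fintype.prod_sum (fun k (m : Fin (N + 1)) => psi (3 * (N : ℝ) * (x k - ((m : ℕ) : ℝ) / N)))]
  exact Finset.prod_eq_one fun k _ => psi_sum N hN (x k) (hx.1 k) (hx.2 k)

/-- Let `n, d ≥ 1`, `ε ∈ (0,1)`, and `f : ℝ^d → ℝ` be `n` times continuously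
differentiable on a neighborhood of `[0,1]^d` with `|∂^α f(x)| ≤ 1` for all
`|α| ≤ n` and `x ∈ [0,1]^d`. If `N = ⌈(2^{d+1} d^n / (n! ε))^{1/n}⌉`, then
`sup_{x ∈ [0,1]^d} |f(x) − f₁(x)| ≤ ε/2`. -/
theorem localized_taylor_approx_eps (n d : ℕ) (hn : 1 ≤ n) (hd : 1 ≤ d)
    (ε : ℝ) (hε : ε ∈ Set.Ioo (0 : ℝ) 1)
    (f : (Fin d → ℝ) → ℝ)
    (U : Set (Fin d → ℝ)) (hUopen : IsOpen U)
    (hUsub : Set.Icc (0 : Fin d → ℝ) 1 ⊆ U)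
    (hf : ContDiffOn ℝ n f U)
    (hbound : ∀ α : Fin d → ℕ, (∑ i, α i) ≤ n →
      ∀ x ∈ Set.Icc (0 : Fin d → ℝ) 1, |multiDeriv α f x| ≤ 1)
    (N : ℕ)
    (hNdef : N = ⌈((2 : ℝ) ^ (d + 1) * (d : ℝ) ^ n
      / ((n.factorial : ℝ) * ε)) ^ ((n : ℝ)⁻¹)⌉₊) :
    ∀ x ∈ Set.Icc (0 : Fin d → ℝ) 1, |f x - f1 d n N f x| ≤ ε / 2 := by
  intro x hx
  obtain ⟨hε0, hε1⟩ := hε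
  have hd0 : (0:ℝ) < d := by exact_mod_cast hd
  set A := (2 : ℝ) ^ (d + 1) * (d : ℝ) ^ n / ((n.factorial : ℝ) * ε) with hA
  have hA0 : 0 < A := by positivity
  have hNr : A ^ ((n : ℝ)⁻¹) ≤ N := by rw [hNdef]; exact Nat.le_ceil _
  have hNp : (0:ℝ) < N := lt_of_lt_of_le (Real.rpow_pos_of_pos hA0 _) hNr
  have hN : 1 ≤ N := by exact_mod_cast hNp
  have hAN : A ≤ (N:ℝ) ^ n := by
    calc A = (A ^ ((n : ℝ)⁻¹)) ^ n := (Real.rpow_inv_natCast_pow hA0.le (by omega)).symm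
      _ ≤ _ := by gcongr
  have hfin : ((d : ℝ) / N) ^ n / n.factorial ≤ ε / 2 := by
    have hp2 : (4:ℝ) ≤ 2 ^ (d + 1) := by
      calc (4:ℝ) = 2 ^ 2 := by norm_num
        _ ≤ _ := pow_le_pow_right₀ (by norm_num) (by omega)
    rw [hA, div_le_iff₀ (by positivity)] at hAN
    rw [div_pow, div_div, div_le_iff₀ (by positivity)]
    have : (0:ℝ) < (d:ℝ) ^ n := by positivity
    nlinarith
  have hloc : ∀ m : Fin d → Fin (N + 1),
      phi d N (fun k => (m k : ℕ)) x * |f x - taylorP d n N f (fun k => (m k : ℕ)) x| ≤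
      phi d N (fun k => (m k : ℕ)) x * (ε / 2) := by
    intro m
    by_cases h0 : phi d N (fun k => (m k : ℕ)) x = 0
    · simp [h0]
    refine mul_le_mul_of_nonneg_left ?_ (phi_nonneg _ _ _ _)
    have hclose : ∀ k, |x k - ((m k : ℕ) : ℝ) / N| ≤ 1 / N := by
      intro k
      by_contra hcon
      push Not at hcon
      apply h0
      refine Finset.prod_eq_zero (Finset.mem_univ k) (psi_eq_zero ?_)
      rw [abs_mul, abs_of_pos (by positivity : (0:ℝ) < 3 * N)]
      rw [div_lt_iff₀ hNp] at hcon
      linarith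
    rw [taylorP_eq hn]
    have hb := taylor_bound hn hUopen hUsub hf hbound (fun i => ((m i : ℕ) : ℝ) / N)
      (fun i => x i - ((m i : ℕ) : ℝ) / N)
      ⟨fun i => by simp; positivity, fun i => by
        simp only [Pi.one_apply]
        rw [div_le_one hNp]
        exact_mod_cast Nat.lt_succ_iff.1 (m i).2⟩
      (by convert hx using 1; ext i; simp)
    have hxe : (fun i => ((m i : ℕ) : ℝ) / N) + (fun i => x i - ((m i : ℕ) : ℝ) / N) = x := by
      ext i; simp
    rw [hxe] at hb
    refine hb.trans (le_trans ?_ hfin)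
    gcongr
    calc _ ≤ ∑ _i : Fin d, (1:ℝ) / N := Finset.sum_le_sum fun i _ => hclose i
      _ = _ := by simp; ring
  have hsum := phi_sum d N hN x hx
  have hdiff : f x - f1 d n N f x = ∑ m : Fin d → Fin (N + 1),
      phi d N (fun k => (m k : ℕ)) x * (f x - taylorP d n N f (fun k => (m k : ℕ)) x) := by
    simp only [mul_sub, Finset.sum_sub_distrib, ← Finset.sum_mul, hsum, one_mul, f1]
  rw [hdiff]
  calc _ ≤ ∑ m : Fin d → Fin (N + 1), |phi d N (fun k => (m k : ℕ)) x *
        (f x - taylorP d n N f (fun k => (m k : ℕ)) x)| := Finset.abs_sum_le_sum_abs _ _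
    _ ≤ ∑ m : Fin d → Fin (N + 1), phi d N (fun k => (m k : ℕ)) x * (ε / 2) := by
        refine Finset.sum_le_sum fun m _ => ?_
        rw [abs_mul, abs_of_nonneg (phi_nonneg _ _ _ _)]
        exact hloc m
    _ = ε / 2 := by rw [← Finset.sum_mul, hsum, one_mul]

end
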